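/- Let f : ℝ → ℝ be three times continuously differentiable on a neighborhood of r, with f(r) = 0 and c₁ := f'(r) ≠ 0, and set c₂ := f''(r)/2 and c₃ := f'''(r)/6. For pairwise distinct points x₀, x₁, x₂ near r (with the relevant denominators nonzero), let x₃ be given by the three-point Secant step x₃ = x₀ - f(x₀)(f(x₂) - f(x₁)) / [ ((f(x₂) - f(x₀))/(x₂ - x₀))·(f(x₂) - f(x₁)) - f(x₂)·( (f(x₂) - f(x₀))/(x₂ - x₀) - (f(x₁) - f(x₀))/(x₁ - x₀) ) ]. Then the error ratio (x₃ - r)/((x₀ - r)(x₁ - r)(x₂ - r)) tends to (c₂² - c₁c₃)/c₁² as the triple (x₀, x₁, x₂) tends to (r, r, r) through pairwise distinct points for which the step is defined. -/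

import Mathlib

open Filter

/-- The three-point Secant step applied to f at the triple (x₀, x₁, x₂). -/
noncomputable def threePointSecantStep (f : ℝ → ℝ) (x₀ x₁ x₂ : ℝ) : ℝ :=
  x₀ - f x₀ * (f x₂ - f x₁) /
    (((f x₂ - f x₀) / (x₂ - x₀)) * (f x₂ - f x₁) -
      f x₂ * ((f x₂ - f x₀) / (x₂ - x₀) - (f x₁ - f x₀) / (x₁ - x₀)))

/-- The set of triples of pairwise distinct points, all different from r, for which
the three-point Secant step (and the error ratio) is defined. -/
def threePointSecantDomain (f : ℝ → ℝ) (r : ℝ) : Set (ℝ × ℝ × ℝ) :=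
  {p | p.1 ≠ p.2.1 ∧ p.1 ≠ p.2.2 ∧ p.2.1 ≠ p.2.2 ∧
    p.1 ≠ r ∧ p.2.1 ≠ r ∧ p.2.2 ≠ r ∧
    ((f p.2.2 - f p.1) / (p.2.2 - p.1)) * (f p.2.2 - f p.2.1) -
      f p.2.2 * ((f p.2.2 - f p.1) / (p.2.2 - p.1) -
        (f p.2.1 - f p.1) / (p.2.1 - p.1)) ≠ 0}

/-- divided difference of order one -/
noncomputable def dvd1 (f : ℝ → ℝ) (a b : ℝ) : ℝ := (f b - f a) / (b - a)

/-- divided difference of order two -/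
noncomputable def dvd2 (f : ℝ → ℝ) (a b c : ℝ) : ℝ := (dvd1 f a c - dvd1 f a b) / (c - b)

/-- divided difference of order three -/
noncomputable def dvd3 (f : ℝ → ℝ) (a b c d : ℝ) : ℝ := (dvd2 f a b d - dvd2 f a b c) / (d - c)

lemma rolle_step {l u : ℝ} {F F' : ℝ → ℝ} (h : ∀ x ∈ Set.Ioo l u, HasDerivAt F (F' x) x)
    {a b : ℝ} (ha : l < a) (hb : b < u) (hab : a < b) (h0 : F a = 0) (h1 : F b = 0) :
    ∃ c, a < c ∧ c < b ∧ F' c = 0 := by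
  obtain ⟨c, hc, hc'⟩ := exists_hasDerivAt_eq_zero (f := F) (f' := F') hab
    (fun x hx => (h x ⟨lt_of_lt_of_le ha hx.1, lt_of_le_of_lt hx.2 hb⟩).continuousAt.continuousWithinAt)
    (by rw [h0, h1]) (fun x hx => h x ⟨ha.trans hx.1, hx.2.trans hb⟩)
  exact ⟨c, hc.1, hc.2, hc'⟩

lemma rolle2 {l u : ℝ} {F F1 F2 : ℝ → ℝ} (h1 : ∀ x ∈ Set.Ioo l u, HasDerivAt F (F1 x) x)
    (h2 : ∀ x ∈ Set.Ioo l u, HasDerivAt F1 (F2 x) x)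
    {a b c : ℝ} (ha : l < a) (hab : a < b) (hbc : b < c) (hc : c < u)
    (fa : F a = 0) (fb : F b = 0) (fc : F c = 0) :
    ∃ x, a < x ∧ x < c ∧ F2 x = 0 := by
  obtain ⟨p, hp1, hp2, hp⟩ := rolle_step h1 ha (hbc.trans hc) hab fa fb
  obtain ⟨q, hq1, hq2, hq⟩ := rolle_step h1 (ha.trans hab) hc hbc fb fc
  obtain ⟨x, hx1, hx2, hx⟩ := rolle_step h2 (ha.trans hp1) (hq2.trans hc) (hp2.trans hq1) hp hq
  exact ⟨x, by linarith, by linarith, hx⟩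

lemma rolle3 {l u : ℝ} {F F1 F2 F3 : ℝ → ℝ} (h1 : ∀ x ∈ Set.Ioo l u, HasDerivAt F (F1 x) x)
    (h2 : ∀ x ∈ Set.Ioo l u, HasDerivAt F1 (F2 x) x)
    (h3 : ∀ x ∈ Set.Ioo l u, HasDerivAt F2 (F3 x) x)
    {a b c d : ℝ} (ha : l < a) (hab : a < b) (hbc : b < c) (hcd : c < d) (hd : d < u)
    (fa : F a = 0) (fb : F b = 0) (fc : F c = 0) (fd : F d = 0) :
    ∃ x, a < x ∧ x < d ∧ F3 x = 0 := by
  obtain ⟨p, hp1, hp2, hp⟩ := rolle_step h1 ha (by linarith) hab fa fb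
  obtain ⟨q, hq1, hq2, hq⟩ := rolle_step h1 (by linarith) (by linarith) hbc fb fc
  obtain ⟨s, hs1, hs2, hs⟩ := rolle_step h1 (by linarith) hd hcd fc fd
  obtain ⟨x, hx1, hx2, hx⟩ := rolle2 h2 h3 (by linarith) (hp2.trans hq1) (hq2.trans hs1)
    (by linarith) hp hq hs
  exact ⟨x, by linarith, by linarith, hx⟩

lemma mean1 {l u : ℝ} {f f1 : ℝ → ℝ} (h1 : ∀ x ∈ Set.Ioo l u, HasDerivAt f (f1 x) x)
    {a b : ℝ} (ha : a ∈ Set.Ioo l u) (hb : b ∈ Set.Ioo l u) (hab : a ≠ b) :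
    ∃ x ∈ Set.Ioo l u, dvd1 f a b = f1 x := by
  set B := dvd1 f a b with hB
  have hba : b - a ≠ 0 := sub_ne_zero.2 hab.symm
  set F : ℝ → ℝ := fun x => f x - (f a + B * (x - a)) with hF
  have H1 : ∀ x ∈ Set.Ioo l u, HasDerivAt F (f1 x - B) x := by
    intro x hx
    have := (h1 x hx).sub ((((hasDerivAt_id x).sub_const a).const_mul B).const_add (f a))
    refine this.congr_deriv ?_
    simp
  have Fa : F a = 0 := by simp [hF]
  have Fb : F b = 0 := by simp only [hF, hB, dvd1]; field_simp; ring
  rcases lt_or_gt_of_ne hab with h | h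
  · obtain ⟨x, h1, h2, h3⟩ := rolle_step H1 ha.1 hb.2 h Fa Fb
    exact ⟨x, ⟨ha.1.trans h1, h2.trans hb.2⟩, by linarith⟩
  · obtain ⟨x, h1, h2, h3⟩ := rolle_step H1 hb.1 ha.2 h Fb Fa
    exact ⟨x, ⟨hb.1.trans h1, h2.trans ha.2⟩, by linarith⟩

lemma mean2 {l u : ℝ} {f f1 f2 : ℝ → ℝ} (h1 : ∀ x ∈ Set.Ioo l u, HasDerivAt f (f1 x) x)
    (h2 : ∀ x ∈ Set.Ioo l u, HasDerivAt f1 (f2 x) x)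
    {a b c : ℝ} (ha : a ∈ Set.Ioo l u) (hb : b ∈ Set.Ioo l u) (hc : c ∈ Set.Ioo l u)
    (hab : a ≠ b) (hac : a ≠ c) (hbc : b ≠ c) :
    ∃ x ∈ Set.Ioo l u, dvd2 f a b c = f2 x / 2 := by
  set C := dvd2 f a b c with hC
  have hba : b - a ≠ 0 := sub_ne_zero.2 hab.symm
  have hca : c - a ≠ 0 := sub_ne_zero.2 hac.symm
  have hcb : c - b ≠ 0 := sub_ne_zero.2 hbc.symm
  set B := dvd1 f a b - C * (a + b) with hB
  set A := f a - dvd1 f a b * a + C * (a * b) with hA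
  set F : ℝ → ℝ := fun x => f x - (A + B * x + C * x ^ 2) with hF
  have H1 : ∀ x ∈ Set.Ioo l u, HasDerivAt F (f1 x - (B + 2 * C * x)) x := by
    intro x hx
    have := (h1 x hx).sub ((((hasDerivAt_id x).const_mul B).const_add A).add
      (((hasDerivAt_id x).pow 2).const_mul C))
    refine this.congr_deriv ?_
    simp; ring
  have H2 : ∀ x ∈ Set.Ioo l u, HasDerivAt (fun x => f1 x - (B + 2 * C * x)) (f2 x - 2 * C) x := by
    intro x hx
    have := (h2 x hx).sub (((hasDerivAt_id x).const_mul (2 * C)).const_add B)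
    refine this.congr_deriv ?_
    simp
  have Fa : F a = 0 := by simp only [hF, hA, hB]; ring
  have Fb : F b = 0 := by simp only [hF, hA, hB, dvd1]; field_simp; ring
  have Fc : F c = 0 := by simp only [hF, hA, hB, hC, dvd2, dvd1]; field_simp; ring
  have S : ∀ x ∈ ({a, b, c} : Finset ℝ), x ∈ Set.Ioo l u ∧ F x = 0 := by
    intro x hx
    simp only [Finset.mem_insert, Finset.mem_singleton] at hx
    rcases hx with rfl | rfl | rfl <;> exact ⟨by assumption, by assumption⟩
  have hcard : ({a, b, c} : Finset ℝ).card = 3 := Finset.card_eq_three.2 ⟨a, b, c, hab, hac, hbc, rfl⟩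
  let e := ({a, b, c} : Finset ℝ).orderEmbOfFin hcard
  have he : ∀ i, e i ∈ Set.Ioo l u ∧ F (e i) = 0 := fun i => S _ (Finset.orderEmbOfFin_mem _ hcard i)
  obtain ⟨x, hx1, hx2, hx⟩ := rolle2 H1 H2 (he 0).1.1 (e.strictMono (by decide : (0 : Fin 3) < 1))
    (e.strictMono (by decide : (1 : Fin 3) < 2)) (he 2).1.2 (he 0).2 (he 1).2 (he 2).2
  exact ⟨x, ⟨(he 0).1.1.trans hx1, hx2.trans (he 2).1.2⟩, by linarith⟩

lemma mean3 {l u : ℝ} {f f1 f2 f3 : ℝ → ℝ} (h1 : ∀ x ∈ Set.Ioo l u, HasDerivAt f (f1 x) x)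
    (h2 : ∀ x ∈ Set.Ioo l u, HasDerivAt f1 (f2 x) x)
    (h3 : ∀ x ∈ Set.Ioo l u, HasDerivAt f2 (f3 x) x)
    {a b c d : ℝ} (ha : a ∈ Set.Ioo l u) (hb : b ∈ Set.Ioo l u) (hc : c ∈ Set.Ioo l u)
    (hd : d ∈ Set.Ioo l u)
    (hab : a ≠ b) (hac : a ≠ c) (had : a ≠ d) (hbc : b ≠ c) (hbd : b ≠ d) (hcd : c ≠ d) :
    ∃ x ∈ Set.Ioo l u, dvd3 f a b c d = f3 x / 6 := by
  set D := dvd3 f a b c d with hD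
  have hba : b - a ≠ 0 := sub_ne_zero.2 hab.symm
  have hca : c - a ≠ 0 := sub_ne_zero.2 hac.symm
  have hcb : c - b ≠ 0 := sub_ne_zero.2 hbc.symm
  have hda : d - a ≠ 0 := sub_ne_zero.2 had.symm
  have hdb : d - b ≠ 0 := sub_ne_zero.2 hbd.symm
  have hdc : d - c ≠ 0 := sub_ne_zero.2 hcd.symm
  have e1 : f b = f a + dvd1 f a b * (b - a) := by simp only [dvd1]; field_simp; ring
  have e2 : f c = f a + dvd1 f a c * (c - a) := by simp only [dvd1]; field_simp; ring
  have e3 : f d = f a + dvd1 f a d * (d - a) := by simp only [dvd1]; field_simp; ring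
  have e4 : dvd1 f a c = dvd1 f a b + dvd2 f a b c * (c - b) := by
    simp only [dvd2]; field_simp; ring
  have e5 : dvd1 f a d = dvd1 f a b + dvd2 f a b d * (d - b) := by
    simp only [dvd2]; field_simp; ring
  have e6 : dvd2 f a b d = dvd2 f a b c + D * (d - c) := by
    simp only [hD, dvd3]; field_simp; ring
  set C := dvd2 f a b c - D * (a + b + c) with hC
  set B := dvd1 f a b - dvd2 f a b c * (a + b) + D * (a * b + b * c + c * a) with hB
  set A := f a - dvd1 f a b * a + dvd2 f a b c * (a * b) - D * (a * b * c) with hA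
  set F : ℝ → ℝ := fun x => f x - (A + B * x + C * x ^ 2 + D * x ^ 3) with hF
  have H1 : ∀ x ∈ Set.Ioo l u, HasDerivAt F (f1 x - (B + 2 * C * x + 3 * D * x ^ 2)) x := by
    intro x hx
    have := (h1 x hx).sub (((((hasDerivAt_id x).const_mul B).const_add A).add
      (((hasDerivAt_id x).pow 2).const_mul C)).add (((hasDerivAt_id x).pow 3).const_mul D))
    refine this.congr_deriv ?_
    simp; ring
  have H2 : ∀ x ∈ Set.Ioo l u, HasDerivAt (fun x => f1 x - (B + 2 * C * x + 3 * D * x ^ 2))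
      (f2 x - (2 * C + 6 * D * x)) x := by
    intro x hx
    have := (h2 x hx).sub ((((hasDerivAt_id x).const_mul (2 * C)).const_add B).add
      (((hasDerivAt_id x).pow 2).const_mul (3 * D)))
    refine this.congr_deriv ?_
    simp; ring
  have H3 : ∀ x ∈ Set.Ioo l u, HasDerivAt (fun x => f2 x - (2 * C + 6 * D * x))
      (f3 x - 6 * D) x := by
    intro x hx
    have := (h3 x hx).sub (((hasDerivAt_id x).const_mul (6 * D)).const_add (2 * C))
    refine this.congr_deriv ?_
    simp
  have Fa : F a = 0 := by simp only [hF, hA, hB, hC]; ring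
  have Fb : F b = 0 := by simp only [hF, hA, hB, hC]; rw [e1]; ring
  have Fc : F c = 0 := by simp only [hF, hA, hB, hC]; rw [e2, e4]; ring
  have Fd : F d = 0 := by simp only [hF, hA, hB, hC]; rw [e3, e5, e6]; ring
  have S : ∀ x ∈ ({a, b, c, d} : Finset ℝ), x ∈ Set.Ioo l u ∧ F x = 0 := by
    intro x hx
    simp only [Finset.mem_insert, Finset.mem_singleton] at hx
    rcases hx with h | h | h | h <;> rw [h] <;> exact ⟨by assumption, by assumption⟩
  have hcard : ({a, b, c, d} : Finset ℝ).card = 4 := by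
    simp [Finset.card_insert_of_notMem, *]
  let e := ({a, b, c, d} : Finset ℝ).orderEmbOfFin hcard
  have he : ∀ i, e i ∈ Set.Ioo l u ∧ F (e i) = 0 := fun i => S _ (Finset.orderEmbOfFin_mem _ hcard i)
  obtain ⟨x, hx1, hx2, hx⟩ := rolle3 H1 H2 H3 (he 0).1.1 (e.strictMono (by decide : (0 : Fin 4) < 1))
    (e.strictMono (by decide : (1 : Fin 4) < 2)) (e.strictMono (by decide : (2 : Fin 4) < 3))
    (he 3).1.2 (he 0).2 (he 1).2 (he 2).2 (he 3).2
  exact ⟨x, ⟨(he 0).1.1.trans hx1, hx2.trans (he 3).1.2⟩, by linarith⟩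

lemma tendsto_of_mean {r ε : ℝ} (hε : 0 < ε) {S : Set (ℝ × ℝ × ℝ)} {g : ℝ → ℝ}
    (hg : ContinuousAt g r) {d : ℝ × ℝ × ℝ → ℝ}
    (h : ∀ δ, 0 < δ → δ ≤ ε → ∀ p ∈ S, p.1 ∈ Set.Ioo (r - δ) (r + δ) →
      p.2.1 ∈ Set.Ioo (r - δ) (r + δ) → p.2.2 ∈ Set.Ioo (r - δ) (r + δ) →
      ∃ x ∈ Set.Ioo (r - δ) (r + δ), d p = g x) :
    Tendsto d (nhdsWithin (r, r, r) S) (nhds (g r)) := by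
  rw [Metric.tendsto_nhdsWithin_nhds]
  intro η hη
  obtain ⟨δ, hδ, H⟩ := Metric.continuousAt_iff.1 hg η hη
  refine ⟨min δ ε, lt_min hδ hε, ?_⟩
  intro p hp hd
  rw [Prod.dist_eq, Prod.dist_eq, max_lt_iff, max_lt_iff] at hd
  simp only [← Metric.mem_ball, Real.ball_eq_Ioo] at hd
  obtain ⟨x, hx, hx'⟩ := h _ (lt_min hδ hε) (min_le_right _ _) p hp hd.1 hd.2.1 hd.2.2
  rw [hx']
  apply H
  rw [← Real.ball_eq_Ioo] at hx
  exact lt_of_lt_of_le hx (min_le_left _ _)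

lemma ratio_eq (f : ℝ → ℝ) (r a b c : ℝ) (hr : f r = 0)
    (h : (a, b, c) ∈ threePointSecantDomain f r) :
    (threePointSecantStep f a b c - r) / ((a - r) * (b - r) * (c - r)) =
      (dvd2 f r b c * dvd2 f r a c - dvd1 f r c * dvd3 f r a b c) /
        (dvd1 f a c * dvd1 f b c - f c * dvd2 f a b c) := by
  obtain ⟨hab, hac, hbc, har, hbr, hcr, hD⟩ := h
  simp only at hab hac hbc har hbr hcr hD
  have hba : b - a ≠ 0 := sub_ne_zero.2 hab.symm
  have hca : c - a ≠ 0 := sub_ne_zero.2 hac.symm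
  have hcb : c - b ≠ 0 := sub_ne_zero.2 hbc.symm
  have ha : a - r ≠ 0 := sub_ne_zero.2 har
  have hb : b - r ≠ 0 := sub_ne_zero.2 hbr
  have hc : c - r ≠ 0 := sub_ne_zero.2 hcr
  have ya : f a = (a - r) * dvd1 f r a := by simp only [dvd1, hr]; field_simp; ring
  have yb : f b = (b - r) * dvd1 f r b := by simp only [dvd1, hr]; field_simp; ring
  have yc : f c = (c - r) * dvd1 f r c := by simp only [dvd1, hr]; field_simp; ring
  have sac : dvd1 f a c = dvd1 f r a + (c - r) * dvd2 f r a c := by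
    rw [dvd1, dvd2, ya, yc]; field_simp; ring
  have sab : dvd1 f a b = dvd1 f r a + (b - r) * dvd2 f r a b := by
    rw [dvd1, dvd2, ya, yb]; field_simp; ring
  have sbc : dvd1 f b c = dvd1 f r c + (b - r) * dvd2 f r b c := by
    rw [dvd1, dvd2, yb, yc]; field_simp; ring
  have t : dvd2 f a b c = dvd2 f r a c + (b - r) * dvd3 f r a b c := by
    rw [dvd2, dvd3, sac, sab]; field_simp; ring
  have z1 : f c - f b = (c - b) * dvd1 f b c := by rw [dvd1]; field_simp
  have z2 : dvd1 f a c - dvd1 f a b = (c - b) * dvd2 f a b c := by rw [dvd2]; field_simp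
  have hden : (f c - f a) / (c - a) * (f c - f b) -
      f c * ((f c - f a) / (c - a) - (f b - f a) / (b - a)) =
      (c - b) * (dvd1 f a c * dvd1 f b c - f c * dvd2 f a b c) := by
    change dvd1 f a c * (f c - f b) - f c * (dvd1 f a c - dvd1 f a b) = _
    rw [z1, z2]; ring
  rw [threePointSecantStep]
  rw [hden] at hD ⊢
  have hQ := right_ne_zero_of_mul hD
  have key : a * (dvd1 f a c * dvd1 f b c - f c * dvd2 f a b c) - f a * dvd1 f b c
      - r * (dvd1 f a c * dvd1 f b c - f c * dvd2 f a b c) =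
      (dvd2 f r b c * dvd2 f r a c - dvd1 f r c * dvd3 f r a b c) *
        ((a - r) * (b - r) * (c - r)) := by
    rw [sac, sbc, t, ya, yc]; ring
  rw [z1]
  generalize dvd1 f a c * dvd1 f b c - f c * dvd2 f a b c = Q at *
  rw [div_eq_div_iff (by positivity) hQ, ← key]
  field_simp

lemma exists_derivs {f : ℝ → ℝ} {r : ℝ} (hf : ∃ U ∈ nhds r, ContDiffOn ℝ 3 f U) :
    ∃ ε > 0, (∀ x ∈ Set.Ioo (r - ε) (r + ε), HasDerivAt f (iteratedDeriv 1 f x) x) ∧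
      (∀ x ∈ Set.Ioo (r - ε) (r + ε), HasDerivAt (iteratedDeriv 1 f) (iteratedDeriv 2 f x) x) ∧
      (∀ x ∈ Set.Ioo (r - ε) (r + ε), HasDerivAt (iteratedDeriv 2 f) (iteratedDeriv 3 f x) x) ∧
      ContinuousAt (iteratedDeriv 3 f) r := by
  obtain ⟨U, hU, h⟩ := hf
  obtain ⟨ε, hε, hb⟩ := Metric.mem_nhds_iff.1 hU
  rw [Real.ball_eq_Ioo] at hb
  have h := h.mono hb
  have ho : IsOpen (Set.Ioo (r - ε) (r + ε)) := isOpen_Ioo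
  obtain ⟨d1, -, h⟩ := (contDiffOn_succ_iff_deriv_of_isOpen (n := 2) ho).1 (by norm_num; exact h)
  obtain ⟨d2, -, h⟩ := (contDiffOn_succ_iff_deriv_of_isOpen (n := 1) ho).1 (by norm_num; exact h)
  obtain ⟨d3, -, h⟩ := (contDiffOn_succ_iff_deriv_of_isOpen (n := 0) ho).1 (by norm_num; exact h)
  have i1 : iteratedDeriv 1 f = deriv f := iteratedDeriv_one
  have i2 : iteratedDeriv 2 f = deriv (deriv f) := by rw [iteratedDeriv_succ, i1]
  have i3 : iteratedDeriv 3 f = deriv (deriv (deriv f)) := by rw [iteratedDeriv_succ, i2]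
  refine ⟨ε, hε, ?_, ?_, ?_, ?_⟩
  · intro x hx; rw [i1]; exact (d1.differentiableAt (ho.mem_nhds hx)).hasDerivAt
  · intro x hx; rw [i1, i2]; exact (d2.differentiableAt (ho.mem_nhds hx)).hasDerivAt
  · intro x hx; rw [i2, i3]; exact (d3.differentiableAt (ho.mem_nhds hx)).hasDerivAt
  · rw [i3]; exact h.continuousOn.continuousAt (ho.mem_nhds ⟨by linarith, by linarith⟩)

/-- Asymptotic error constant of the three-point Secant method: if f is three times
continuously differentiable near a simple root r, with c₁ = f'(r) ≠ 0, c₂ = f''(r)/2,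
c₃ = f'''(r)/6, then the error ratio (x₃ - r)/((x₀ - r)(x₁ - r)(x₂ - r)) of the
three-point Secant step tends to (c₂² - c₁c₃)/c₁² as (x₀, x₁, x₂) → (r, r, r) through
pairwise distinct points for which the step is defined. -/
theorem three_point_secant_error_constant
    (f : ℝ → ℝ) (r : ℝ) (hroot : f r = 0)
    (hf : ∃ U ∈ nhds r, ContDiffOn ℝ 3 f U)
    (c₁ c₂ c₃ : ℝ)
    (hc1 : c₁ = iteratedDeriv 1 f r) (hc1ne : c₁ ≠ 0)
    (hc2 : c₂ = iteratedDeriv 2 f r / 2)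
    (hc3 : c₃ = iteratedDeriv 3 f r / 6) :
    Tendsto
      (fun p : ℝ × ℝ × ℝ =>
        (threePointSecantStep f p.1 p.2.1 p.2.2 - r) /
          ((p.1 - r) * (p.2.1 - r) * (p.2.2 - r)))
      (nhdsWithin (r, r, r) (threePointSecantDomain f r))
      (nhds ((c₂ ^ 2 - c₁ * c₃) / c₁ ^ 2)) := by
  obtain ⟨ε, hε, H1, H2, H3, k3⟩ := exists_derivs hf
  have hrm : ∀ δ, 0 < δ → r ∈ Set.Ioo (r - δ) (r + δ) := fun δ h => ⟨by linarith, by linarith⟩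
  have k0 := (H1 r (hrm ε hε)).continuousAt
  have k1 := (H2 r (hrm ε hε)).continuousAt
  have k2 := (H3 r (hrm ε hε)).continuousAt
  have sub : ∀ δ, δ ≤ ε → Set.Ioo (r - δ) (r + δ) ⊆ Set.Ioo (r - ε) (r + ε) :=
    fun δ h => Set.Ioo_subset_Ioo (by linarith) (by linarith)
  set S := threePointSecantDomain f r with hS
  have T1 : ∀ u v : ℝ × ℝ × ℝ → ℝ,
      (∀ δ, 0 < δ → ∀ p ∈ S, p.1 ∈ Set.Ioo (r - δ) (r + δ) →
      p.2.1 ∈ Set.Ioo (r - δ) (r + δ) → p.2.2 ∈ Set.Ioo (r - δ) (r + δ) →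
      u p ∈ Set.Ioo (r - δ) (r + δ) ∧ v p ∈ Set.Ioo (r - δ) (r + δ) ∧ u p ≠ v p) →
      Tendsto (fun p => dvd1 f (u p) (v p)) (nhdsWithin (r, r, r) S) (nhds c₁) := by
    intro u v h
    rw [hc1]
    refine tendsto_of_mean hε k1 ?_
    intro δ h0 hδ p hp h1 h2 h3
    obtain ⟨a, b, c⟩ := h δ h0 p hp h1 h2 h3
    exact mean1 (fun x hx => H1 x (sub δ hδ hx)) a b c
  have T2 : ∀ u v w : ℝ × ℝ × ℝ → ℝ,
      (∀ δ, 0 < δ → ∀ p ∈ S, p.1 ∈ Set.Ioo (r - δ) (r + δ) →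
      p.2.1 ∈ Set.Ioo (r - δ) (r + δ) → p.2.2 ∈ Set.Ioo (r - δ) (r + δ) →
      u p ∈ Set.Ioo (r - δ) (r + δ) ∧ v p ∈ Set.Ioo (r - δ) (r + δ) ∧
      w p ∈ Set.Ioo (r - δ) (r + δ) ∧ u p ≠ v p ∧ u p ≠ w p ∧ v p ≠ w p) →
      Tendsto (fun p => dvd2 f (u p) (v p) (w p)) (nhdsWithin (r, r, r) S) (nhds c₂) := by
    intro u v w h
    rw [hc2]
    refine tendsto_of_mean (g := fun x => iteratedDeriv 2 f x / 2) hε (k2.div_const 2) ?_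
    intro δ h0 hδ p hp h1 h2 h3
    obtain ⟨a, b, c, d, e, g⟩ := h δ h0 p hp h1 h2 h3
    exact mean2 (fun x hx => H1 x (sub δ hδ hx)) (fun x hx => H2 x (sub δ hδ hx)) a b c d e g
  have T3 : Tendsto (fun p : ℝ × ℝ × ℝ => dvd3 f r p.1 p.2.1 p.2.2)
      (nhdsWithin (r, r, r) S) (nhds c₃) := by
    rw [hc3]
    refine tendsto_of_mean (g := fun x => iteratedDeriv 3 f x / 6) hε (k3.div_const 6) ?_
    intro δ h0 hδ p hp h1 h2 h3
    obtain ⟨hab, hac, hbc, har, hbr, hcr, hD⟩ := hp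
    exact mean3 (fun x hx => H1 x (sub δ hδ hx)) (fun x hx => H2 x (sub δ hδ hx))
      (fun x hx => H3 x (sub δ hδ hx)) (hrm δ h0) h1 h2 h3 har.symm hbr.symm hcr.symm hab hac hbc
  have T0 : Tendsto (fun p : ℝ × ℝ × ℝ => f p.2.2) (nhdsWithin (r, r, r) S) (nhds 0) := by
    rw [← hroot]
    refine tendsto_of_mean hε k0 ?_
    intro δ h0 hδ p hp h1 h2 h3
    exact ⟨_, h3, rfl⟩
  have A1 := T2 (fun _ => r) (fun p => p.2.1) (fun p => p.2.2) (by
    intro δ h0 p ⟨hab, hac, hbc, har, hbr, hcr, hD⟩ h1 h2 h3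
    exact ⟨hrm δ h0, h2, h3, hbr.symm, hcr.symm, hbc⟩)
  have A2 := T2 (fun _ => r) (fun p => p.1) (fun p => p.2.2) (by
    intro δ h0 p ⟨hab, hac, hbc, har, hbr, hcr, hD⟩ h1 h2 h3
    exact ⟨hrm δ h0, h1, h3, har.symm, hcr.symm, hac⟩)
  have A3 := T2 (fun p => p.1) (fun p => p.2.1) (fun p => p.2.2) (by
    intro δ h0 p ⟨hab, hac, hbc, har, hbr, hcr, hD⟩ h1 h2 h3
    exact ⟨h1, h2, h3, hab, hac, hbc⟩)
  have B1 := T1 (fun _ => r) (fun p => p.2.2) (by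
    intro δ h0 p ⟨hab, hac, hbc, har, hbr, hcr, hD⟩ h1 h2 h3
    exact ⟨hrm δ h0, h3, hcr.symm⟩)
  have B2 := T1 (fun p => p.1) (fun p => p.2.2) (by
    intro δ h0 p ⟨hab, hac, hbc, har, hbr, hcr, hD⟩ h1 h2 h3
    exact ⟨h1, h3, hac⟩)
  have B3 := T1 (fun p => p.2.1) (fun p => p.2.2) (by
    intro δ h0 p ⟨hab, hac, hbc, har, hbr, hcr, hD⟩ h1 h2 h3
    exact ⟨h2, h3, hbc⟩)
  have L := ((A1.mul A2).sub (B1.mul T3)).div ((B2.mul B3).sub (T0.mul A3))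
    (by simpa using hc1ne)
  have e : (c₂ * c₂ - c₁ * c₃) / (c₁ * c₁ - 0 * c₂) = (c₂ ^ 2 - c₁ * c₃) / c₁ ^ 2 := by
    congr 1 <;> ring
  rw [e] at L
  refine L.congr' ?_
  filter_upwards [self_mem_nhdsWithin] with p hp
  exact (ratio_eq f r p.1 p.2.1 p.2.2 hroot hp).symm
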